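/- The axiomatization RML is sound and complete for refinement modal logic: for every formula φ of L_∀, ⊢ φ if and only if ⊨ φ. -/

import Mathlib

/-- A Kripke model over agents `A` and propositional variables `P`. -/
structure KModel (A P : Type) where
  S : Type
  R : A → S → S → Prop
  V : P → S → Prop

/-- `Refines B M s N t`: there is a `B`-refinement from `M_s` to `N_t`. -/
def Refines {A P : Type} (B : Set A) (M : KModel A P) (s : M.S)
    (N : KModel A P) (t : N.S) : Prop :=
  ∃ Z : M.S → N.S → Prop,
    Z s t ∧
    (∀ u v, Z u v → ∀ p, M.V p u ↔ N.V p v) ∧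
    (∀ a : A, ∀ u v, Z u v → ∀ v', N.R a v v' → ∃ u', M.R a u u' ∧ Z u' v') ∧
    (∀ a : A, a ∉ B → ∀ u v, Z u v → ∀ u', M.R a u u' → ∃ v', N.R a v v' ∧ Z u' v')

/-- The language `L_∀` of refinement modal logic. -/
inductive RForm (A P : Type) : Type where
  | atom : P → RForm A P
  | neg : RForm A P → RForm A P
  | and : RForm A P → RForm A P → RForm A P
  | box : A → RForm A P → RForm A P
  | rall : A → RForm A P → RForm A P

/-- Satisfaction for refinement modal logic. -/
def Sat {A P : Type} : (M : KModel A P) → M.S → RForm A P → Prop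
  | M, s, .atom p => M.V p s
  | M, s, .neg φ => ¬ Sat M s φ
  | M, s, .and φ ψ => Sat M s φ ∧ Sat M s ψ
  | M, s, .box a φ => ∀ t, M.R a s t → Sat M t φ
  | M, s, .rall a φ => ∀ (N : KModel A P) (t : N.S), Refines {a} M s N t → Sat N t φ

/-- Material implication `φ → ψ`, as an abbreviation. -/
def fimp {A P : Type} (φ ψ : RForm A P) : RForm A P := .neg (.and φ (.neg ψ))

/-- Biimplication `φ ↔ ψ`, as an abbreviation. -/
def fiff {A P : Type} (φ ψ : RForm A P) : RForm A P := .and (fimp φ ψ) (fimp ψ φ)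

/-- `◇_a φ := ¬□_a ¬φ`. -/
def fdia {A P : Type} (a : A) (φ : RForm A P) : RForm A P := .neg (.box a (.neg φ))

/-- `∃_a φ := ¬∀_a ¬φ`. -/
def fex {A P : Type} (a : A) (φ : RForm A P) : RForm A P := .neg (.rall a (.neg φ))

/-- A formula is valid iff it is true at every pointed model. -/
def Valid {A P : Type} (φ : RForm A P) : Prop :=
  ∀ (M : KModel A P) (s : M.S), Sat M s φ

/-- `⊥` (using a fixed propositional variable). -/
def fbot {A P : Type} [Inhabited P] : RForm A P :=
  .and (.atom default) (.neg (.atom default))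

/-- `⊤`. -/
def ftop {A P : Type} [Inhabited P] : RForm A P := .neg fbot

/-- Disjunction, as an abbreviation. -/
def forr {A P : Type} (φ ψ : RForm A P) : RForm A P := .neg (.and (.neg φ) (.neg ψ))

/-- Big disjunction `⋁ Φ` of a finite list of formulas (`⋁ ∅ = ⊥`). -/
def disjList {A P : Type} [Inhabited P] : List (RForm A P) → RForm A P
  | [] => fbot
  | [φ] => φ
  | φ :: ψ :: l => forr φ (disjList (ψ :: l))

/-- Big conjunction `⋀ Φ` of a finite list of formulas (`⋀ ∅ = ⊤`). -/
def conjList {A P : Type} [Inhabited P] : List (RForm A P) → RForm A P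
  | [] => ftop
  | [φ] => φ
  | φ :: ψ :: l => .and φ (conjList (ψ :: l))

/-- The cover operator `∇_a Φ := □_a ⋁ Φ ∧ ⋀_{φ ∈ Φ} ◇_a φ`. -/
def cover {A P : Type} [Inhabited P] (a : A) (l : List (RForm A P)) : RForm A P :=
  .and (.box a (disjList l)) (conjList (l.map (fdia a)))

/-- Propositional evaluation treating atoms, boxes and refinement quantifiers as
propositional atoms. -/
def pEval {A P : Type} (v : RForm A P → Prop) : RForm A P → Prop
  | .neg φ => ¬ pEval v φ
  | .and φ ψ => pEval v φ ∧ pEval v ψ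
  | .atom p => v (.atom p)
  | .box a φ => v (.box a φ)
  | .rall a φ => v (.rall a φ)

/-- `φ` is a substitution instance of a propositional tautology. -/
def Taut {A P : Type} (φ : RForm A P) : Prop := ∀ v, pEval v φ

/-- Derivability in the axiomatization **RML**. -/
inductive Deriv {A P : Type} [Inhabited P] : RForm A P → Prop where
  /-- **Prop**: all (substitution instances of) propositional tautologies. -/
  | prop {φ} : Taut φ → Deriv φ
  /-- **K**. -/
  | axK (a : A) (φ ψ : RForm A P) :
      Deriv (fimp (.box a (fimp φ ψ)) (fimp (.box a φ) (.box a ψ)))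
  /-- **R**. -/
  | axR (a : A) (φ ψ : RForm A P) :
      Deriv (fimp (.rall a (fimp φ ψ)) (fimp (.rall a φ) (.rall a ψ)))
  /-- **RProp**, positive half. -/
  | axRProp1 (a : A) (p : P) : Deriv (fiff (.rall a (.atom p)) (.atom p))
  /-- **RProp**, negative half. -/
  | axRProp2 (a : A) (p : P) :
      Deriv (fiff (.rall a (.neg (.atom p))) (.neg (.atom p)))
  /-- **RK**: `∃_a ∇_a Φ ↔ ⋀_{φ∈Φ} ◇_a ∃_a φ`. -/
  | axRK (a : A) (Φ : List (RForm A P)) :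
      Deriv (fiff (fex a (cover a Φ))
        (conjList (Φ.map (fun φ => fdia a (fex a φ)))))
  /-- **RKmulti**: `∃_a ∇_b Φ ↔ ∇_b (∃_a Φ)` for `b ≠ a`. -/
  | axRKmulti (a b : A) (hba : b ≠ a) (Φ : List (RForm A P)) :
      Deriv (fiff (fex a (cover b Φ)) (cover b (Φ.map (fex a))))
  /-- **RKconj**: `∃_a ⋀_{b∈B} ∇_b Φᵇ ↔ ⋀_{b∈B} ∃_a ∇_b Φᵇ` for `B ⊆ A`. -/
  | axRKconj (a : A) (L : List (A × List (RForm A P)))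
      (hB : (L.map Prod.fst).Nodup) :
      Deriv (fiff (fex a (conjList (L.map (fun bl => cover bl.1 bl.2))))
        (conjList (L.map (fun bl => fex a (cover bl.1 bl.2)))))
  /-- **MP**. -/
  | mp {φ ψ} : Deriv (fimp φ ψ) → Deriv φ → Deriv ψ
  /-- **NecK**. -/
  | necK (a : A) {φ} : Deriv φ → Deriv (.box a φ)
  /-- **NecR**. -/
  | necR (a : A) {φ} : Deriv φ → Deriv (.rall a φ)

theorem Refines.refl {A P : Type} (B : Set A) (M : KModel A P) (s : M.S) : Refines B M s M s := by
  refine ⟨Eq, rfl, ?_, ?_, ?_⟩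
  · rintro u _ rfl p
    exact Iff.rfl
  · rintro a u _ rfl v h
    exact ⟨v, h, rfl⟩
  · rintro a - u _ rfl v h
    exact ⟨v, h, rfl⟩

theorem Refines.trans {A P : Type} {B C : Set A} (hBC : B ⊆ C) {M N K : KModel A P}
    {s : M.S} {t : N.S} {k : K.S} (h₁ : Refines B M s N t) (h₂ : Refines C N t K k) : Refines C M s K k := by
  obtain ⟨Z, hst, atoms, back, forth⟩ := h₁
  obtain ⟨Z', htk, atoms', back', forth'⟩ := h₂
  refine ⟨fun u w => ∃ v, Z u v ∧ Z' v w, ⟨t, hst, htk⟩, ?_, ?_, ?_⟩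
  · rintro u w ⟨v, huv, hvw⟩ p
    exact (atoms u v huv p).trans (atoms' v w hvw p)
  · rintro a u w ⟨v, huv, hvw⟩ w' hw
    obtain ⟨v', hv, hz'⟩ := back' a v w hvw w' hw
    obtain ⟨u', hu, hz⟩ := back a u v huv v' hv
    exact ⟨u', hu, v', hz, hz'⟩
  · rintro a ha u w ⟨v, huv, hvw⟩ u' hu
    obtain ⟨v', hv, hz⟩ := forth a (fun h => ha (hBC h)) u v huv u' hu
    obtain ⟨w', hw, hz'⟩ := forth' a ha v w hvw v' hv
    exact ⟨w', hw, v', hz, hz'⟩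

theorem Refines.symm {A P : Type} {M N : KModel A P} {s : M.S} {t : N.S} (h : Refines ∅ M s N t) :
    Refines ∅ N t M s := by
  obtain ⟨Z, hst, atoms, back, forth⟩ := h
  exact ⟨fun v u => Z u v, hst, fun v u hz p => (atoms u v hz p).symm,
    fun a v u hz u' hu => forth a (Set.notMem_empty a) u v hz u' hu,
    fun a _ v u hz v' hv => back a u v hz v' hv⟩

theorem Refines.atoms {A P : Type} {B : Set A} {M N : KModel A P} {s : M.S} {t : N.S}
    (h : Refines B M s N t) (p : P) : M.V p s ↔ N.V p t := by
  obtain ⟨Z, hst, atoms, -⟩ := h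
  exact atoms s t hst p

theorem Refines.back {A P : Type} {B : Set A} {M N : KModel A P} {s : M.S} {t : N.S}
    (h : Refines B M s N t) {a : A} {t' : N.S} (ht : N.R a t t') :
    ∃ s', M.R a s s' ∧ Refines B M s' N t' := by
  obtain ⟨Z, hst, atoms, back, forth⟩ := h
  obtain ⟨s', hs, hz⟩ := back a s t hst t' ht
  exact ⟨s', hs, Z, hz, atoms, back, forth⟩

theorem Refines.forth {A P : Type} {B : Set A} {M N : KModel A P} {s : M.S} {t : N.S}
    (h : Refines B M s N t) {a : A} (ha : a ∉ B) {s' : M.S} (hs : M.R a s s') :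
    ∃ t', N.R a t t' ∧ Refines B M s' N t' := by
  obtain ⟨Z, hst, atoms, back, forth⟩ := h
  obtain ⟨t', ht, hz⟩ := forth a ha s t hst s' hs
  exact ⟨t', ht, Z, hz, atoms, back, forth⟩

namespace RML

/-! ### Gluing of models -/

section Semantics

variable {A P : Type}

theorem sat_iff_of_bisim (φ : RForm A P) : ∀ {M N : KModel A P} {s : M.S} {t : N.S},
    Refines ∅ M s N t → (Sat M s φ ↔ Sat N t φ) := by
  induction φ with
  | atom p => exact fun h => h.atoms p
  | neg φ ih => exact fun h => not_congr (ih h)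
  | and φ ψ ih₁ ih₂ => exact fun h => and_congr (ih₁ h) (ih₂ h)
  | box a φ ih =>
    intro M N s t h
    constructor
    · intro hs t' ht
      obtain ⟨s', hs', hr⟩ := h.back ht
      exact (ih hr).1 (hs s' hs')
    · intro ht s' hs
      obtain ⟨t', ht', hr⟩ := h.forth (Set.notMem_empty a) hs
      exact (ih hr).2 (ht t' ht')
  | rall a φ _ =>
    intro M N s t h
    exact ⟨fun hs K k hk => hs K k (h.trans (Set.empty_subset _) hk),
      fun ht K k hk => ht K k (h.symm.trans (Set.empty_subset _) hk)⟩

/-- The disjoint union of the models `N i` together with a new root that satisfies the atoms of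
`s` and has the points `t i` with `E b i` as its `b`-successors. -/
def glue (M : KModel A P) (s : M.S) {I : Type} (N : I → KModel A P) (t : ∀ i, (N i).S)
    (E : A → I → Prop) : KModel A P where
  S := Option (Σ i, (N i).S)
  R b x y := (x = none ∧ ∃ i, E b i ∧ y = some ⟨i, t i⟩) ∨
    ∃ i u v, (N i).R b u v ∧ x = some ⟨i, u⟩ ∧ y = some ⟨i, v⟩
  V p x := x.elim (M.V p s) fun y => (N y.1).V p y.2

section Glue

variable (M : KModel A P) (s : M.S) {I : Type} (N : I → KModel A P) (t : ∀ i, (N i).S)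
  (E : A → I → Prop)

theorem glue_R_none (b : A) (y : (glue M s N t E).S) :
    (glue M s N t E).R b none y ↔ ∃ i, E b i ∧ y = some ⟨i, t i⟩ := by
  simp [glue]

theorem glue_R_some (b : A) (i : I) (u : (N i).S) (y : (glue M s N t E).S) :
    (glue M s N t E).R b (some ⟨i, u⟩) y ↔ ∃ v, (N i).R b u v ∧ y = some ⟨i, v⟩ := by
  constructor
  · rintro (⟨h, -⟩ | ⟨j, u', v, h, hx, rfl⟩)
    · cases h
    · cases hx
      exact ⟨v, h, rfl⟩
  · rintro ⟨v, h, rfl⟩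
    exact Or.inr ⟨i, u, v, h, rfl, rfl⟩

theorem bisim_glue (i : I) (u : (N i).S) :
    Refines ∅ (N i) u (glue M s N t E) (some ⟨i, u⟩) := by
  refine ⟨fun v y => y = some ⟨i, v⟩, rfl, ?_, ?_, ?_⟩
  · rintro v _ rfl p
    exact Iff.rfl
  · rintro b v _ rfl y hy
    exact (glue_R_some M s N t E b i v y).1 hy
  · rintro b - v _ rfl v' hv
    exact ⟨_, (glue_R_some M s N t E b i v _).2 ⟨v', hv, rfl⟩, rfl⟩

end Glue

theorem exists_refinement_of_family (M : KModel A P) (s : M.S) (a : A) {I : Type}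
    (N : I → KModel A P) (t : ∀ i, (N i).S) (E : A → I → Prop)
    (hback : ∀ b i, E b i → ∃ u, M.R b s u ∧ Refines {a} M u (N i) (t i))
    (hforth : ∀ b, b ≠ a → ∀ u, M.R b s u → ∃ i, E b i ∧ Refines {a} M u (N i) (t i)) :
    ∃ (K : KModel A P) (k : K.S), Refines {a} M s K k ∧
      ∀ b φ, Sat K k (.box b φ) ↔ ∀ i, E b i → Sat (N i) (t i) φ := by
  refine ⟨glue M s N t E, none, ?_, fun b φ => ?_⟩
  · refine ⟨fun x y => (x = s ∧ y = none) ∨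
      ∃ i u, y = some ⟨i, u⟩ ∧ Refines {a} M x (N i) u, Or.inl ⟨rfl, rfl⟩, ?_, ?_, ?_⟩
    · rintro x y (⟨rfl, rfl⟩ | ⟨i, u, rfl, h⟩) p
      · exact Iff.rfl
      · exact h.atoms p
    · rintro b x y (⟨rfl, rfl⟩ | ⟨i, u, rfl, h⟩) y' hy
      · obtain ⟨i, hi, rfl⟩ := (glue_R_none M x N t E b y').1 hy
        obtain ⟨w, hw, hr⟩ := hback b i hi
        exact ⟨w, hw, Or.inr ⟨i, t i, rfl, hr⟩⟩
      · obtain ⟨v, hv, rfl⟩ := (glue_R_some M s N t E b i u y').1 hy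
        obtain ⟨w, hw, hr⟩ := h.back hv
        exact ⟨w, hw, Or.inr ⟨i, v, rfl, hr⟩⟩
    · rintro b hb x y (⟨rfl, rfl⟩ | ⟨i, u, rfl, h⟩) x' hx
      · obtain ⟨i, hi, hr⟩ := hforth b hb x' hx
        exact ⟨some ⟨i, t i⟩, (glue_R_none M x N t E b _).2 ⟨i, hi, rfl⟩,
          Or.inr ⟨i, t i, rfl, hr⟩⟩
      · obtain ⟨v, hv, hr⟩ := h.forth hb hx
        exact ⟨some ⟨i, v⟩, (glue_R_some M s N t E b i u _).2 ⟨v, hv, rfl⟩,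
          Or.inr ⟨i, v, rfl, hr⟩⟩
  · constructor
    · intro h i hi
      exact (sat_iff_of_bisim φ (bisim_glue M s N t E i (t i))).2
        (h _ ((glue_R_none M s N t E b _).2 ⟨i, hi, rfl⟩))
    · intro h y hy
      obtain ⟨i, hi, rfl⟩ := (glue_R_none M s N t E b y).1 hy
      exact (sat_iff_of_bisim φ (bisim_glue M s N t E i (t i))).1 (h i hi)

theorem exists_refinement_replacing_successors (M : KModel A P) (s : M.S) (a b : A) {I : Type}
    (N : I → KModel A P) (t : ∀ i, (N i).S)
    (hback : ∀ i, ∃ u, M.R b s u ∧ Refines {a} M u (N i) (t i))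
    (hforth : b ≠ a → ∀ u, M.R b s u → ∃ i, Refines {a} M u (N i) (t i)) :
    ∃ (K : KModel A P) (k : K.S), Refines {a} M s K k ∧
      ∀ φ, Sat K k (.box b φ) ↔ ∀ i, Sat (N i) (t i) φ := by
  have family := exists_refinement_of_family M s a (I := I ⊕ M.S)
    (Sum.elim N fun _ => M) (fun i => match i with | .inl i => t i | .inr u => u)
    (fun c i => match i with | .inl _ => c = b | .inr u => c ≠ b ∧ M.R c s u)
  obtain ⟨K, k, hr, hK⟩ := family
    (by
      rintro c (i | u) hi
      · cases hi
        exact hback i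
      · exact ⟨u, hi.2, Refines.refl _ M u⟩)
    (by
      intro c hc u hu
      by_cases hcb : c = b
      · subst hcb
        obtain ⟨i, hi⟩ := hforth hc u hu
        exact ⟨.inl i, rfl, hi⟩
      · exact ⟨.inr u, ⟨hcb, hu⟩, Refines.refl _ M u⟩)
  refine ⟨K, k, hr, fun φ => (hK b φ).trans ⟨fun h i => h (.inl i) rfl, fun h i => ?_⟩⟩
  rcases i with i | u
  · exact fun _ => h i
  · exact fun hu => absurd rfl hu.1

theorem exists_refinement_combining (M : KModel A P) (s : M.S) (a : A)
    (N : A → KModel A P) (t : ∀ b, (N b).S) (h : ∀ b, Refines {a} M s (N b) (t b)) :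
    ∃ (K : KModel A P) (k : K.S), Refines {a} M s K k ∧
      ∀ b φ, Sat K k (.box b φ) ↔ Sat (N b) (t b) (.box b φ) := by
  have family := exists_refinement_of_family M s a
    (I := Σ b, {v : (N b).S // (N b).R b (t b) v}) (fun i => N i.1) (fun i => i.2.1)
    (fun b i => i.1 = b)
  obtain ⟨K, k, hr, hK⟩ := family
    (by
      rintro b ⟨_, v, hv⟩ rfl
      exact (h _).back hv)
    (by
      intro b hb u hu
      obtain ⟨v, hv, hr⟩ := (h b).forth hb hu
      exact ⟨⟨b, v, hv⟩, rfl, hr⟩)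
  refine ⟨K, k, hr, fun b φ => (hK b φ).trans ⟨fun h v hv => h ⟨b, v, hv⟩ rfl, ?_⟩⟩
  rintro h ⟨_, v, hv⟩ rfl
  exact h v hv

/-! ### Satisfaction of the derived connectives -/

variable (M : KModel A P) (s : M.S)

theorem sat_fimp (φ ψ : RForm A P) : Sat M s (fimp φ ψ) ↔ (Sat M s φ → Sat M s ψ) := by
  simp [fimp, Sat]

theorem sat_fiff (φ ψ : RForm A P) : Sat M s (fiff φ ψ) ↔ (Sat M s φ ↔ Sat M s ψ) := by
  rw [fiff, Sat, sat_fimp, sat_fimp, ← iff_iff_implies_and_implies]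

theorem sat_fdia (a : A) (φ : RForm A P) :
    Sat M s (fdia a φ) ↔ ∃ t, M.R a s t ∧ Sat M t φ := by
  simp [fdia, Sat]

theorem sat_fex (a : A) (φ : RForm A P) :
    Sat M s (fex a φ) ↔ ∃ (N : KModel A P) (t : N.S), Refines {a} M s N t ∧ Sat N t φ := by
  simp [fex, Sat]

variable [Inhabited P]

theorem sat_conjList (l : List (RForm A P)) :
    Sat M s (conjList l) ↔ ∀ φ ∈ l, Sat M s φ := by
  induction l using conjList.induct with
  | case1 => simp [conjList, ftop, fbot, Sat]
  | case2 φ => simp [conjList]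
  | case3 φ ψ l ih => rw [conjList, Sat, ih, List.forall_mem_cons (a := φ)]

theorem sat_disjList (l : List (RForm A P)) :
    Sat M s (disjList l) ↔ ∃ φ ∈ l, Sat M s φ := by
  induction l using disjList.induct with
  | case1 => simp [disjList, fbot, Sat]
  | case2 φ => simp [disjList]
  | case3 φ ψ l ih =>
    rw [disjList, forr, Sat, Sat, Sat, Sat, ih, List.exists_mem_cons_iff (a := φ), or_iff_not_and_not]

theorem sat_cover (b : A) (l : List (RForm A P)) :
    Sat M s (cover b l) ↔ Sat M s (.box b (disjList l)) ∧
      ∀ φ ∈ l, ¬ Sat M s (.box b (.neg φ)) := by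
  simp [cover, Sat, sat_conjList, fdia]

theorem sat_cover_iff (b : A) (l : List (RForm A P)) :
    Sat M s (cover b l) ↔ (∀ t, M.R b s t → ∃ φ ∈ l, Sat M t φ) ∧
      ∀ φ ∈ l, ∃ t, M.R b s t ∧ Sat M t φ := by
  simp [cover, Sat, sat_conjList, sat_disjList, sat_fdia]

/-! ### Soundness -/

omit [Inhabited P] in
theorem sat_iff_pEval (φ : RForm A P) : pEval (Sat M s) φ ↔ Sat M s φ := by
  induction φ with
  | neg φ ih => exact not_congr ih
  | and φ ψ ih₁ ih₂ => exact and_congr ih₁ ih₂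
  | _ => exact Iff.rfl

theorem valid_RK (a : A) (l : List (RForm A P)) :
    Sat M s (fex a (cover a l)) ↔
      Sat M s (conjList (l.map fun φ => fdia a (fex a φ))) := by
  simp only [sat_fex, sat_conjList, List.forall_mem_map, sat_fdia]
  constructor
  · rintro ⟨N, t, hr, hc⟩ φ hφ
    obtain ⟨t', ht, hs⟩ := ((sat_cover_iff N t a l).1 hc).2 φ hφ
    obtain ⟨u, hu, hr'⟩ := hr.back ht
    exact ⟨u, hu, N, t', hr', hs⟩
  · intro h
    have h' : ∀ φ : {φ // φ ∈ l}, ∃ u, M.R a s u ∧ ∃ (N : KModel A P) (t : N.S),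
      Refines {a} M u N t ∧ Sat N t φ := fun φ => h φ φ.2
    choose u hu N t hr hs using h'
    obtain ⟨K, k, hK, hbox⟩ := exists_refinement_replacing_successors M s a a N t
      (fun φ => ⟨u φ, hu φ, hr φ⟩) (fun h => absurd rfl h)
    refine ⟨K, k, hK, (sat_cover K k a l).2 ⟨(hbox _).2 fun φ => ?_, fun φ hφ hn => ?_⟩⟩
    · exact (sat_disjList _ _ l).2 ⟨φ, φ.2, hs φ⟩
    · exact (hbox _).1 hn ⟨φ, hφ⟩ (hs ⟨φ, hφ⟩)

theorem valid_RKmulti (a b : A) (hba : b ≠ a) (l : List (RForm A P)) :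
    Sat M s (fex a (cover b l)) ↔ Sat M s (cover b (l.map (fex a))) := by
  rw [sat_fex, sat_cover_iff]
  simp only [List.forall_mem_map]
  simp only [List.mem_map, exists_exists_and_eq_and]
  constructor
  · rintro ⟨N, t, hr, hc⟩
    rw [sat_cover_iff] at hc
    constructor
    · intro u hu
      obtain ⟨t', ht, hr'⟩ := hr.forth hba hu
      obtain ⟨φ, hφ, hs⟩ := hc.1 t' ht
      exact ⟨φ, hφ, (sat_fex M u a φ).2 ⟨N, t', hr', hs⟩⟩
    · intro φ hφ
      obtain ⟨t', ht, hs⟩ := hc.2 φ hφ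
      obtain ⟨u, hu, hr'⟩ := hr.back ht
      exact ⟨u, hu, (sat_fex M u a φ).2 ⟨N, t', hr', hs⟩⟩
  · rintro ⟨h₁, h₂⟩
    have h' : ∀ x : {x : M.S × RForm A P // M.R b s x.1 ∧ x.2 ∈ l ∧ Sat M x.1 (fex a x.2)},
        ∃ (N : KModel A P) (t : N.S), Refines {a} M x.1.1 N t ∧ Sat N t x.1.2 :=
      fun x => (sat_fex M _ a _).1 x.2.2.2
    choose N t hr hs using h'
    obtain ⟨K, k, hK, hbox⟩ := exists_refinement_replacing_successors M s a b N t
      (fun x => ⟨x.1.1, x.2.1, hr x⟩) (fun _ u hu => by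
        obtain ⟨φ, hφ, hsat⟩ := h₁ u hu
        exact ⟨⟨(u, φ), hu, hφ, hsat⟩, hr _⟩)
    refine ⟨K, k, hK, (sat_cover K k b l).2 ⟨(hbox _).2 fun x => ?_, fun φ hφ hn => ?_⟩⟩
    · exact (sat_disjList _ _ l).2 ⟨_, x.2.2.1, hs x⟩
    · obtain ⟨u, hu, hsat⟩ := h₂ φ hφ
      exact (hbox _).1 hn ⟨(u, φ), hu, hφ, hsat⟩ (hs ⟨(u, φ), hu, hφ, hsat⟩)

theorem valid_RKconj (a : A) (L : List (A × List (RForm A P))) (hL : (L.map Prod.fst).Nodup) :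
    Sat M s (fex a (conjList (L.map fun bl => cover bl.1 bl.2))) ↔
      Sat M s (conjList (L.map fun bl => fex a (cover bl.1 bl.2))) := by
  simp only [sat_fex, sat_conjList, List.forall_mem_map]
  constructor
  · rintro ⟨N, t, hr, h⟩ bl hbl
    exact ⟨N, t, hr, h bl hbl⟩
  · intro h
    have h' : ∀ b : A, ∃ (N : KModel A P) (t : N.S), Refines {a} M s N t ∧
        ∀ bl ∈ L, bl.1 = b → Sat N t (cover bl.1 bl.2) := by
      intro b
      by_cases hb : ∃ bl ∈ L, bl.1 = b
      · obtain ⟨bl, hbl, rfl⟩ := hb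
        obtain ⟨N, t, hr, hs⟩ := h bl hbl
        refine ⟨N, t, hr, fun bl' hbl' heq => ?_⟩
        rwa [List.inj_on_of_nodup_map hL hbl' hbl heq]
      · exact ⟨M, s, Refines.refl _ M s, fun bl hbl heq => absurd ⟨bl, hbl, heq⟩ hb⟩
    choose N t hr hs using h'
    obtain ⟨K, k, hK, hbox⟩ := exists_refinement_combining M s a N t hr
    refine ⟨K, k, hK, fun bl hbl => ?_⟩
    have := hs bl.1 bl hbl rfl
    simpa only [sat_cover, hbox] using this

theorem sound {φ : RForm A P} (h : Deriv φ) : Valid φ := by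
  induction h with
  | prop h => exact fun M s => (sat_iff_pEval M s _).1 (h _)
  | axK a φ ψ =>
    intro M s
    simp only [sat_fimp, Sat]
    exact fun h₁ h₂ t ht => h₁ t ht (h₂ t ht)
  | axR a φ ψ =>
    intro M s
    simp only [sat_fimp, Sat]
    exact fun h₁ h₂ N t ht => h₁ N t ht (h₂ N t ht)
  | axRProp1 a p =>
    intro M s
    simp only [sat_fiff, Sat]
    exact ⟨fun h => h M s (Refines.refl _ M s), fun h N t hr => (hr.atoms p).1 h⟩
  | axRProp2 a p =>
    intro M s
    simp only [sat_fiff, Sat]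
    exact ⟨fun h => h M s (Refines.refl _ M s), fun h N t hr ht => h ((hr.atoms p).2 ht)⟩
  | axRK a l => exact fun M s => (sat_fiff M s _ _).2 (valid_RK M s a l)
  | axRKmulti a b hba l => exact fun M s => (sat_fiff M s _ _).2 (valid_RKmulti M s a b hba l)
  | axRKconj a L hL => exact fun M s => (sat_fiff M s _ _).2 (valid_RKconj M s a L hL)
  | mp _ _ ih₁ ih₂ => exact fun M s => (sat_fimp M s _ _).1 (ih₁ M s) (ih₂ M s)
  | necK a _ ih => exact fun M s t _ => ih M t
  | necR a _ ih => exact fun M s N t _ => ih N t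

end Semantics

/-! ### Maximal consistent theories -/

section Canonical

variable {A P : Type} [Inhabited P]

/-- A set of formulas that contains all theorems and is closed under modus ponens. -/
structure IsTheory (T : Set (RForm A P)) : Prop where
  deriv : ∀ {φ}, Deriv φ → φ ∈ T
  mp : ∀ {φ ψ}, fimp φ ψ ∈ T → φ ∈ T → ψ ∈ T

/-- A theory that contains exactly one of `φ` and `¬φ`, for each formula `φ`. -/
structure IsMCS (Γ : Set (RForm A P)) : Prop extends IsTheory Γ where
  neg_mem : ∀ {φ}, .neg φ ∈ Γ ↔ φ ∉ Γ

theorem IsTheory.taut {T : Set (RForm A P)} (hT : IsTheory T) {φ : RForm A P} (h : Taut φ) :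
    φ ∈ T :=
  hT.deriv (.prop h)

theorem isTheory_setOf_deriv : IsTheory {φ : RForm A P | Deriv φ} :=
  ⟨id, Deriv.mp⟩

theorem IsTheory.adjoin {T : Set (RForm A P)} (hT : IsTheory T) (χ : RForm A P) :
    IsTheory {ψ | fimp χ ψ ∈ T} where
  deriv {φ} h := by
    refine hT.mp (hT.taut (φ := fimp φ (fimp χ φ)) fun v => ?_) (hT.deriv h)
    simp only [fimp, pEval]
    tauto
  mp {φ ψ} h₁ h₂ := by
    refine hT.mp (hT.mp (hT.taut
      (φ := fimp (fimp χ (fimp φ ψ)) (fimp (fimp χ φ) (fimp χ ψ))) fun v => ?_) h₁) h₂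
    simp only [fimp, pEval]
    tauto

theorem IsTheory.exists_isMCS {T : Set (RForm A P)} (hT : IsTheory T) {φ : RForm A P}
    (hφ : φ ∉ T) : ∃ Γ, IsMCS Γ ∧ T ⊆ Γ ∧ φ ∉ Γ := by
  obtain ⟨Γ, hTΓ, ⟨hΓ, hφΓ⟩, hmax⟩ := zorn_subset_nonempty
    {T : Set (RForm A P) | IsTheory T ∧ φ ∉ T} (fun c hc hchain hne => by
      refine ⟨⋃₀ c, ⟨⟨fun h => ?_, ?_⟩, ?_⟩, fun _ => Set.subset_sUnion_of_mem⟩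
      · obtain ⟨U, hU⟩ := hne
        exact ⟨U, hU, (hc hU).1.deriv h⟩
      · rintro χ ψ ⟨U, hU, h₁⟩ ⟨W, hW, h₂⟩
        rcases hchain.total hU hW with h | h
        · exact ⟨W, hW, (hc hW).1.mp (h h₁) h₂⟩
        · exact ⟨U, hU, (hc hU).1.mp h₁ (h h₂)⟩
      · rintro ⟨U, hU, h⟩
        exact (hc hU).2 h) T ⟨hT, hφ⟩
  have key : ∀ χ, χ ∉ Γ → fimp χ φ ∈ Γ := by
    intro χ hχ
    by_contra hn
    refine hχ (hmax ⟨hΓ.adjoin χ, hn⟩ (fun ψ hψ => ?_) (hΓ.taut fun v => ?_))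
    · refine hΓ.mp (hΓ.taut (φ := fimp ψ (fimp χ ψ)) fun v => ?_) hψ
      simp only [fimp, pEval]
      tauto
    · simp only [fimp, pEval]
      tauto
  refine ⟨Γ, ⟨hΓ, fun {χ} => ⟨fun h₁ h₂ => hφΓ ?_, fun h₁ => ?_⟩⟩, hTΓ, hφΓ⟩
  · refine hΓ.mp (hΓ.mp (hΓ.taut (φ := fimp (.neg χ) (fimp χ φ)) fun v => ?_) h₁) h₂
    simp only [fimp, pEval]
    tauto
  · by_contra h₂
    refine hφΓ (hΓ.mp (hΓ.mp (hΓ.taut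
      (φ := fimp (fimp χ φ) (fimp (fimp (.neg χ) φ) φ)) fun v => ?_) (key _ h₁)) (key _ h₂))
    simp only [fimp, pEval]
    tauto

theorem deriv_of_forall_mem {φ : RForm A P} (h : ∀ Γ, IsMCS Γ → φ ∈ Γ) : Deriv φ := by
  by_contra hn
  obtain ⟨Γ, hΓ, -, hφ⟩ := isTheory_setOf_deriv.exists_isMCS hn
  exact hφ (h Γ hΓ)

namespace IsMCS

variable {Γ : Set (RForm A P)} (hΓ : IsMCS Γ)

include hΓ

theorem and_mem {φ ψ : RForm A P} : .and φ ψ ∈ Γ ↔ φ ∈ Γ ∧ ψ ∈ Γ := by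
  refine ⟨fun h => ⟨hΓ.mp (hΓ.taut fun v => ?_) h, hΓ.mp (hΓ.taut fun v => ?_) h⟩,
    fun h => hΓ.mp (hΓ.mp (hΓ.taut fun v => ?_) h.1) h.2⟩ <;>
  · simp only [fimp, pEval]
    tauto

theorem fimp_mem {φ ψ : RForm A P} : fimp φ ψ ∈ Γ ↔ (φ ∈ Γ → ψ ∈ Γ) := by
  rw [fimp, hΓ.neg_mem, hΓ.and_mem, hΓ.neg_mem]
  tauto

theorem mem_iff_of_deriv {φ ψ : RForm A P} (h : Deriv (fiff φ ψ)) : φ ∈ Γ ↔ ψ ∈ Γ := by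
  have := hΓ.deriv h
  rw [fiff, hΓ.and_mem, hΓ.fimp_mem, hΓ.fimp_mem] at this
  exact ⟨this.1, this.2⟩

theorem fbot_notMem : fbot ∉ Γ := by
  rw [fbot, hΓ.and_mem, hΓ.neg_mem]
  tauto

theorem conjList_mem (l : List (RForm A P)) : conjList l ∈ Γ ↔ ∀ φ ∈ l, φ ∈ Γ := by
  induction l using conjList.induct with
  | case1 => simp [conjList, ftop, hΓ.neg_mem, hΓ.fbot_notMem]
  | case2 φ => simp [conjList]
  | case3 φ ψ l ih => rw [conjList, hΓ.and_mem, ih, List.forall_mem_cons (a := φ)]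

theorem disjList_mem (l : List (RForm A P)) : disjList l ∈ Γ ↔ ∃ φ ∈ l, φ ∈ Γ := by
  induction l using disjList.induct with
  | case1 => simp [disjList, hΓ.fbot_notMem]
  | case2 φ => simp [disjList]
  | case3 φ ψ l ih =>
    rw [disjList, forr, hΓ.neg_mem, hΓ.and_mem, hΓ.neg_mem, hΓ.neg_mem, ih,
      List.exists_mem_cons_iff (a := φ), or_iff_not_and_not]

theorem normal_mem {O : RForm A P → RForm A P}
    (hK : ∀ φ ψ, Deriv (fimp (O (fimp φ ψ)) (fimp (O φ) (O ψ))))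
    (hN : ∀ φ, Deriv φ → Deriv (O φ)) {φ : RForm A P} :
    O φ ∈ Γ ↔ ∀ Δ, IsMCS Δ → (∀ ψ, O ψ ∈ Γ → ψ ∈ Δ) → φ ∈ Δ := by
  refine ⟨fun h Δ _ hΔ => hΔ φ h, fun h => ?_⟩
  by_contra hn
  have hT : IsTheory {ψ | O ψ ∈ Γ} :=
    ⟨fun h => hΓ.deriv (hN _ h), fun h₁ h₂ => hΓ.mp (hΓ.mp (hΓ.deriv (hK _ _)) h₁) h₂⟩
  obtain ⟨Δ, hΔ, hsub, hφ⟩ := hT.exists_isMCS hn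
  exact hφ (h Δ hΔ hsub)

theorem box_mem {a : A} {φ : RForm A P} :
    .box a φ ∈ Γ ↔ ∀ Δ, IsMCS Δ → (∀ ψ, .box a ψ ∈ Γ → ψ ∈ Δ) → φ ∈ Δ :=
  hΓ.normal_mem (.axK a) fun _ => .necK a

theorem rall_mem {a : A} {φ : RForm A P} :
    .rall a φ ∈ Γ ↔ ∀ Δ, IsMCS Δ → (∀ ψ, .rall a ψ ∈ Γ → ψ ∈ Δ) → φ ∈ Δ :=
  hΓ.normal_mem (.axR a) fun _ => .necR a

theorem fex_mem {a : A} {φ : RForm A P} :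
    fex a φ ∈ Γ ↔ ∃ Δ, IsMCS Δ ∧ (∀ ψ, .rall a ψ ∈ Γ → ψ ∈ Δ) ∧ φ ∈ Δ := by
  rw [fex, hΓ.neg_mem, hΓ.rall_mem]
  push Not
  refine exists_congr fun Δ => and_congr_right fun hΔ => and_congr_right fun _ => ?_
  rw [hΔ.neg_mem, not_not]

theorem atom_mem_iff_of_rall {Δ : Set (RForm A P)} (hΔ : IsMCS Δ) {a : A}
    (h : ∀ ψ, .rall a ψ ∈ Γ → ψ ∈ Δ) (p : P) : .atom p ∈ Γ ↔ .atom p ∈ Δ := by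
  refine ⟨fun hp => h _ ((hΓ.mem_iff_of_deriv (.axRProp1 a p)).2 hp), fun hp => ?_⟩
  by_contra hn
  exact hΔ.neg_mem.1 (h _ ((hΓ.mem_iff_of_deriv (.axRProp2 a p)).2 (hΓ.neg_mem.2 hn))) hp

end IsMCS

/-- Equivalence of formulas in all maximal consistent theories. -/
def MemEquiv (φ ψ : RForm A P) : Prop := ∀ Γ, IsMCS Γ → (φ ∈ Γ ↔ ψ ∈ Γ)

/-- A class of formulas that is closed under the constructors of the `∀`-free language. -/
structure ModalClosed (C : RForm A P → Prop) : Prop where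
  atom : ∀ p, C (.atom p)
  neg : ∀ {φ}, C φ → C (.neg φ)
  and : ∀ {φ ψ}, C φ → C ψ → C (.and φ ψ)
  box : ∀ {a φ}, C φ → C (.box a φ)

namespace ModalClosed

variable {C : RForm A P → Prop} (hC : ModalClosed C)

include hC

theorem fbot : C fbot := hC.and (hC.atom _) (hC.neg (hC.atom _))

omit [Inhabited P] in
theorem fdia {a : A} {φ : RForm A P} (h : C φ) : C (fdia a φ) := hC.neg (hC.box (hC.neg h))

theorem conjList {l : List (RForm A P)} (h : ∀ φ ∈ l, C φ) : C (conjList l) := by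
  induction l using conjList.induct with
  | case1 => exact hC.neg hC.fbot
  | case2 φ => exact h φ (by simp)
  | case3 φ ψ l ih =>
    rw [List.forall_mem_cons] at h
    exact hC.and h.1 (ih h.2)

theorem disjList {l : List (RForm A P)} (h : ∀ φ ∈ l, C φ) : C (disjList l) := by
  induction l using disjList.induct with
  | case1 => exact hC.fbot
  | case2 φ => exact h φ (by simp)
  | case3 φ ψ l ih =>
    rw [List.forall_mem_cons] at h
    exact hC.neg (hC.and (hC.neg h.1) (hC.neg (ih h.2)))

theorem cover {a : A} {l : List (RForm A P)} (h : ∀ φ ∈ l, C φ) : C (cover a l) := by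
  refine hC.and (hC.box (hC.disjList h)) (hC.conjList ?_)
  rw [List.forall_mem_map]
  exact fun φ hφ => hC.fdia (h φ hφ)

end ModalClosed

/-- The `∀`-free formulas. -/
def RFree : RForm A P → Prop
  | .atom _ => True
  | .neg φ => RFree φ
  | .and φ ψ => RFree φ ∧ RFree ψ
  | .box _ φ => RFree φ
  | .rall _ _ => False

omit [Inhabited P] in
theorem modalClosed_rFree : ModalClosed (RFree (A := A) (P := P)) where
  atom _ := trivial
  neg := id
  and := And.intro
  box := id

/-- The formulas that are equivalent to a `∀`-free formula in all maximal consistent theories. -/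
def Reducible (φ : RForm A P) : Prop := ∃ ψ, RFree ψ ∧ MemEquiv φ ψ

theorem Reducible.of_memEquiv {φ ψ : RForm A P} (h : Reducible ψ) (he : MemEquiv φ ψ) :
    Reducible φ := by
  obtain ⟨χ, hχ, h⟩ := h
  exact ⟨χ, hχ, fun Γ hΓ => (he Γ hΓ).trans (h Γ hΓ)⟩

theorem modalClosed_reducible : ModalClosed (Reducible (A := A) (P := P)) where
  atom p := ⟨.atom p, trivial, fun _ _ => Iff.rfl⟩
  neg := by
    rintro φ ⟨ψ, hψ, h⟩
    refine ⟨.neg ψ, hψ, fun Γ hΓ => ?_⟩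
    rw [hΓ.neg_mem, hΓ.neg_mem, h Γ hΓ]
  and := by
    rintro φ φ' ⟨ψ, hψ, h⟩ ⟨ψ', hψ', h'⟩
    refine ⟨.and ψ ψ', ⟨hψ, hψ'⟩, fun Γ hΓ => ?_⟩
    rw [hΓ.and_mem, hΓ.and_mem, h Γ hΓ, h' Γ hΓ]
  box := by
    rintro a φ ⟨ψ, hψ, h⟩
    refine ⟨.box a ψ, hψ, fun Γ hΓ => ?_⟩
    rw [hΓ.box_mem, hΓ.box_mem]
    exact forall₂_congr fun Δ hΔ => by rw [h Δ hΔ]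

/-! ### The canonical model -/

/-- The canonical model. -/
def canonicalModel (A P : Type) [Inhabited P] : KModel A P where
  S := {Γ : Set (RForm A P) // IsMCS Γ}
  R a Γ Δ := ∀ ψ, .box a ψ ∈ Γ.1 → ψ ∈ Δ.1
  V p Γ := .atom p ∈ Γ.1

theorem sat_canonicalModel {φ : RForm A P} (hφ : RFree φ) (Γ : (canonicalModel A P).S) :
    Sat (canonicalModel A P) Γ φ ↔ φ ∈ Γ.1 := by
  induction φ generalizing Γ with
  | atom p => exact Iff.rfl
  | neg φ ih => rw [Sat, ih hφ, Γ.2.neg_mem]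
  | and φ ψ ih₁ ih₂ => rw [Sat, ih₁ hφ.1, ih₂ hφ.2, Γ.2.and_mem]
  | box a φ ih =>
    rw [Γ.2.box_mem]
    exact ⟨fun h Δ hΔ hR => (ih hφ ⟨Δ, hΔ⟩).1 (h ⟨Δ, hΔ⟩ hR),
      fun h Δ hR => (ih hφ Δ).2 (h Δ.1 Δ.2 hR)⟩
  | rall a φ => exact hφ.elim

theorem memEquiv_of_sat_iff {φ ψ : RForm A P} (hφ : RFree φ) (hψ : RFree ψ)
    (h : ∀ (M : KModel A P) (s : M.S), Sat M s φ ↔ Sat M s ψ) : MemEquiv φ ψ := fun Γ hΓ =>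
  ((sat_canonicalModel hφ ⟨Γ, hΓ⟩).symm.trans (h _ _)).trans (sat_canonicalModel hψ ⟨Γ, hΓ⟩)

/-! ### Characteristic formulas of bounded depth -/

/-- The modal depth of a `∀`-free formula. -/
def depth : RForm A P → ℕ
  | .atom _ => 0
  | .neg φ => depth φ
  | .and φ ψ => max (depth φ) (depth ψ)
  | .box _ φ => depth φ + 1
  | .rall _ _ => 0

/-- The agents whose boxes occur in a `∀`-free formula. -/
def agents : RForm A P → List A
  | .atom _ => []
  | .neg φ => agents φ
  | .and φ ψ => agents φ ++ agents ψ
  | .box a φ => a :: agents φ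
  | .rall _ _ => []

/-- The propositional variables that occur in a `∀`-free formula. -/
def vars : RForm A P → List P
  | .atom p => [p]
  | .neg φ => vars φ
  | .and φ ψ => vars φ ++ vars ψ
  | .box _ φ => vars φ
  | .rall _ _ => []

open Classical in
/-- The literal of `p` that is true when exactly the variables in `q` are true. -/
noncomputable def literal (q : List P) (p : P) : RForm A P :=
  if p ∈ q then .atom p else .neg (.atom p)

/-- The formula that prescribes the truth values of the variables in `Q` and the successors of
some agents. -/
noncomputable def characteristic (Q q : List P) (L : List (A × List (RForm A P))) : RForm A P :=
  .and (conjList (Q.map (literal q))) (conjList (L.map fun bl => cover bl.1 bl.2))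

/-- The characteristic formulas of depth `n` in the agents `B` and the variables `Q`. -/
noncomputable def types (B : List A) (Q : List P) : ℕ → List (RForm A P)
  | 0 => Q.sublists.map fun q => characteristic Q q []
  | n + 1 => Q.sublists.flatMap fun q =>
      (List.sections (B.map fun b => (types B Q n).sublists.map (Prod.mk b))).map
        (characteristic Q q)

omit [Inhabited P] in
theorem mem_sections_iff {B : List A} {l : List (RForm A P)} {L : List (A × List (RForm A P))} :
    L ∈ List.sections (B.map fun b => l.sublists.map (Prod.mk b)) ↔
      L.map Prod.fst = B ∧ ∀ bl ∈ L, bl.2.Sublist l := by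
  rw [List.mem_sections, List.forall₂_map_right_iff]
  induction B generalizing L with
  | nil =>
    rw [List.forall₂_nil_right_iff]
    constructor
    · rintro rfl
      simp
    · exact fun h => List.map_eq_nil_iff.1 h.1
  | cons b B ih =>
    rw [List.forall₂_cons_right_iff]
    constructor
    · rintro ⟨bl, L, hbl, hL, rfl⟩
      obtain ⟨x, hx, rfl⟩ := List.mem_map.1 hbl
      obtain ⟨h₁, h₂⟩ := ih.1 hL
      exact ⟨by simp [h₁], List.forall_mem_cons.2 ⟨List.mem_sublists.1 hx, h₂⟩⟩
    · rintro ⟨h₁, h₂⟩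
      rcases L with - | ⟨⟨c, x⟩, L⟩
      · simp at h₁
      · simp only [List.map_cons, List.cons.injEq] at h₁
        obtain ⟨rfl, h₁⟩ := h₁
        rw [List.forall_mem_cons] at h₂
        exact ⟨_, L, List.mem_map.2 ⟨x, List.mem_sublists.2 h₂.1, rfl⟩, ih.2 ⟨h₁, h₂.2⟩, rfl⟩

theorem mem_types_zero {B : List A} {Q : List P} {χ : RForm A P} :
    χ ∈ types B Q 0 ↔ ∃ q, q.Sublist Q ∧ characteristic Q q [] = χ := by
  simp [types]

theorem mem_types_succ {B : List A} {Q : List P} {n : ℕ} {χ : RForm A P} :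
    χ ∈ types B Q (n + 1) ↔ ∃ q L, q.Sublist Q ∧ L.map Prod.fst = B ∧
      (∀ bl ∈ L, bl.2.Sublist (types B Q n)) ∧ characteristic Q q L = χ := by
  simp only [types, List.mem_flatMap, List.mem_map (f := characteristic Q _), mem_sections_iff,
    List.mem_sublists]
  constructor
  · rintro ⟨q, hq, L, ⟨h₁, h₂⟩, h⟩
    exact ⟨q, L, hq, h₁, h₂, h⟩
  · rintro ⟨q, L, hq, h₁, h₂, h⟩
    exact ⟨q, hq, L, ⟨h₁, h₂⟩, h⟩

theorem exists_characteristic {B : List A} {Q : List P} {n : ℕ} {χ : RForm A P}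
    (h : χ ∈ types B Q n) : ∃ q L, characteristic Q q L = χ := by
  cases n with
  | zero =>
    obtain ⟨q, -, h⟩ := mem_types_zero.1 h
    exact ⟨q, _, h⟩
  | succ n =>
    obtain ⟨q, L, -, -, -, h⟩ := mem_types_succ.1 h
    exact ⟨q, L, h⟩

omit [Inhabited P] in
theorem sat_literal (M : KModel A P) (s : M.S) (q : List P) (p : P) :
    Sat M s (literal q p) ↔ (M.V p s ↔ p ∈ q) := by
  unfold literal
  split <;> simp [Sat, *]

theorem sat_characteristic (M : KModel A P) (s : M.S) (Q q : List P)
    (L : List (A × List (RForm A P))) :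
    Sat M s (characteristic Q q L) ↔ (∀ p ∈ Q, M.V p s ↔ p ∈ q) ∧
      ∀ bl ∈ L, Sat M s (cover bl.1 bl.2) := by
  simp only [characteristic, Sat, sat_conjList, List.forall_mem_map, sat_literal]

theorem exists_type (B : List A) (Q : List P) (n : ℕ) (M : KModel A P) (s : M.S) :
    ∃ χ ∈ types B Q n, Sat M s χ := by
  classical
  have hq : ∀ p ∈ Q, M.V p s ↔ p ∈ Q.filter fun p => M.V p s := by
    intro p hp
    simp [hp]
  induction n generalizing s with
  | zero =>
    exact ⟨_, mem_types_zero.2 ⟨_, List.filter_sublist, rfl⟩,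
      (sat_characteristic M s _ _ _).2 ⟨hq, by simp⟩⟩
  | succ n ih =>
    refine ⟨_, mem_types_succ.2 ⟨_, B.map fun b => (b, (types B Q n).filter fun χ =>
      ∃ t, M.R b s t ∧ Sat M t χ), List.filter_sublist, ?_, ?_, rfl⟩,
      (sat_characteristic M s _ _ _).2 ⟨hq, ?_⟩⟩
    · rw [List.map_map]
      exact List.map_id B
    · rw [List.forall_mem_map]
      exact fun b _ => List.filter_sublist
    · rw [List.forall_mem_map]
      intro b _
      rw [sat_cover_iff]
      refine ⟨fun t ht => ?_, fun χ hχ => by simpa using (List.mem_filter.1 hχ).2⟩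
      obtain ⟨χ, hχ, hs⟩ := ih t (by intro p hp; simp [hp])
      exact ⟨χ, List.mem_filter.2 ⟨hχ, by simpa using ⟨t, ht, hs⟩⟩, hs⟩

theorem sat_of_sat_type {B : List A} {Q : List P} (φ : RForm A P) (hφ : RFree φ)
    (hB : agents φ ⊆ B) (hQ : vars φ ⊆ Q) {n : ℕ} (hn : depth φ ≤ n) {χ : RForm A P}
    (hχ : χ ∈ types B Q n) {M N : KModel A P} {s : M.S} {t : N.S} (hs : Sat M s χ)
    (ht : Sat N t χ) (h : Sat M s φ) : Sat N t φ := by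
  induction φ generalizing n χ M N s t with
  | atom p =>
    obtain ⟨q, L, rfl⟩ := exists_characteristic hχ
    rw [sat_characteristic] at hs ht
    have hp : p ∈ Q := hQ (by simp [vars])
    exact (ht.1 p hp).2 ((hs.1 p hp).1 h)
  | neg φ ih => exact fun h' => h (ih hφ hB hQ hn hχ ht hs h')
  | and φ ψ ih₁ ih₂ =>
    rw [agents, List.append_subset] at hB
    rw [vars, List.append_subset] at hQ
    rw [depth, max_le_iff] at hn
    exact ⟨ih₁ hφ.1 hB.1 hQ.1 hn.1 hχ hs ht h.1, ih₂ hφ.2 hB.2 hQ.2 hn.2 hχ hs ht h.2⟩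
  | box b φ ih =>
    rw [agents, List.cons_subset] at hB
    cases n with
    | zero => simp [depth] at hn
    | succ n =>
      obtain ⟨q, L, -, hL, hsub, rfl⟩ := mem_types_succ.1 hχ
      rw [sat_characteristic] at hs ht
      obtain ⟨bl, hbl, rfl⟩ := List.mem_map.1 (hL.symm ▸ hB.1)
      intro t' ht'
      obtain ⟨χ', hχ', hst⟩ := ((sat_cover_iff N t _ _).1 (ht.2 bl hbl)).1 t' ht'
      obtain ⟨s', hs', hss⟩ := ((sat_cover_iff M s _ _).1 (hs.2 bl hbl)).2 χ' hχ'
      exact ih hφ hB.2 hQ (Nat.le_of_succ_le_succ hn) ((hsub bl hbl).subset hχ') hss hst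
        (h s' hs')
  | rall a φ => exact hφ.elim

theorem rFree_characteristic {Q q : List P} {L : List (A × List (RForm A P))}
    (h : ∀ bl ∈ L, ∀ φ ∈ bl.2, RFree φ) : RFree (characteristic Q q L) := by
  refine ⟨modalClosed_rFree.conjList ?_, modalClosed_rFree.conjList ?_⟩
  · rw [List.forall_mem_map]
    intro p _
    unfold literal
    split <;> trivial
  · rw [List.forall_mem_map]
    exact fun bl hbl => modalClosed_rFree.cover (h bl hbl)

theorem rFree_of_mem_types {B : List A} {Q : List P} {n : ℕ} {χ : RForm A P}
    (h : χ ∈ types B Q n) : RFree χ := by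
  induction n generalizing χ with
  | zero =>
    obtain ⟨q, -, rfl⟩ := mem_types_zero.1 h
    exact rFree_characteristic (by simp)
  | succ n ih =>
    obtain ⟨q, L, -, -, hsub, rfl⟩ := mem_types_succ.1 h
    exact rFree_characteristic fun bl hbl φ hφ => ih ((hsub bl hbl).subset hφ)

theorem exists_types_memEquiv {φ : RForm A P} (hφ : RFree φ) :
    ∃ (B : List A) (Q : List P) (n : ℕ) (l : List (RForm A P)), B.Nodup ∧ l ⊆ types B Q n ∧
      MemEquiv φ (disjList l) := by
  classical
  let T := types (agents φ).dedup (vars φ) (depth φ)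
  let l := T.filter fun χ => ∃ (M : KModel A P) (s : M.S), Sat M s χ ∧ Sat M s φ
  have hl : l ⊆ T := List.filter_subset_self T
  refine ⟨_, _, _, l, List.nodup_dedup _, hl, memEquiv_of_sat_iff hφ
    (modalClosed_rFree.disjList fun χ hχ => rFree_of_mem_types (hl hχ)) fun N t => ?_⟩
  rw [sat_disjList]
  constructor
  · intro h
    obtain ⟨χ, hχ, hs⟩ := exists_type (agents φ).dedup (vars φ) (depth φ) N t
    exact ⟨χ, List.mem_filter.2 ⟨hχ, decide_eq_true ⟨N, t, hs, h⟩⟩, hs⟩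
  · rintro ⟨χ, hχ, hs⟩
    obtain ⟨hχ, h⟩ := List.mem_filter.1 hχ
    obtain ⟨M, s, hsχ, hsφ⟩ := of_decide_eq_true h
    exact sat_of_sat_type φ hφ (List.subset_dedup _) (List.Subset.refl _) le_rfl hχ hsχ hs hsφ

/-! ### Elimination of refinement quantifiers -/

theorem reducible_fex_cover (a b : A) {l : List (RForm A P)}
    (h : ∀ φ ∈ l, Reducible (fex a φ)) : Reducible (fex a (cover b l)) := by
  by_cases hba : b = a
  · subst hba
    refine Reducible.of_memEquiv (modalClosed_reducible.conjList ?_)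
      fun Γ hΓ => hΓ.mem_iff_of_deriv (.axRK b l)
    rw [List.forall_mem_map]
    exact fun φ hφ => modalClosed_reducible.fdia (h φ hφ)
  · refine Reducible.of_memEquiv (modalClosed_reducible.cover ?_)
      fun Γ hΓ => hΓ.mem_iff_of_deriv (.axRKmulti a b hba l)
    rwa [List.forall_mem_map]

theorem IsMCS.literal_mem_iff_of_rall {Γ Δ : Set (RForm A P)} (hΓ : IsMCS Γ) (hΔ : IsMCS Δ)
    {a : A} (h : ∀ ψ, .rall a ψ ∈ Γ → ψ ∈ Δ) (q : List P) (p : P) :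
    literal q p ∈ Γ ↔ literal q p ∈ Δ := by
  have := hΓ.atom_mem_iff_of_rall hΔ h p
  unfold literal
  split
  · exact this
  · rw [hΓ.neg_mem, hΔ.neg_mem, this]

theorem reducible_fex_characteristic (a : A) {Q q : List P} {L : List (A × List (RForm A P))}
    (hL : (L.map Prod.fst).Nodup) (h : ∀ bl ∈ L, ∀ φ ∈ bl.2, Reducible (fex a φ)) :
    Reducible (fex a (characteristic Q q L)) := by
  have h₁ : Reducible (conjList (Q.map (literal q)) : RForm A P) :=
    ⟨_, (rFree_characteristic (L := []) (by simp)).1, fun _ _ => Iff.rfl⟩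
  have h₂ : Reducible (fex a (conjList (L.map fun bl => cover bl.1 bl.2))) := by
    refine Reducible.of_memEquiv (modalClosed_reducible.conjList ?_)
      fun Γ hΓ => hΓ.mem_iff_of_deriv (.axRKconj a L hL)
    rw [List.forall_mem_map]
    exact fun bl hbl => reducible_fex_cover a bl.1 (h bl hbl)
  refine Reducible.of_memEquiv (modalClosed_reducible.and h₁ h₂) fun Γ hΓ => ?_
  rw [hΓ.and_mem, hΓ.fex_mem, hΓ.fex_mem, ← exists_and_left]
  refine exists_congr fun Δ => ?_
  rw [and_left_comm (b := IsMCS Δ)]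
  refine and_congr_right fun hΔ => ?_
  rw [and_left_comm (b := ∀ ψ, .rall a ψ ∈ Γ → ψ ∈ Δ)]
  refine and_congr_right fun hR => ?_
  simp only [characteristic, hΔ.and_mem, hΓ.conjList_mem, hΔ.conjList_mem, List.forall_mem_map,
    hΓ.literal_mem_iff_of_rall hΔ hR]

theorem reducible_fex_of_mem_types (a : A) {B : List A} (hB : B.Nodup) {Q : List P} {n : ℕ}
    {χ : RForm A P} (h : χ ∈ types B Q n) : Reducible (fex a χ) := by
  induction n generalizing χ with
  | zero =>
    obtain ⟨q, -, rfl⟩ := mem_types_zero.1 h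
    exact reducible_fex_characteristic a (by simp) (by simp)
  | succ n ih =>
    obtain ⟨q, L, -, hL, hsub, rfl⟩ := mem_types_succ.1 h
    exact reducible_fex_characteristic a (hL ▸ hB) fun bl hbl φ hφ => ih ((hsub bl hbl).subset hφ)

theorem reducible_fex_of_rFree (a : A) {φ : RForm A P} (hφ : RFree φ) : Reducible (fex a φ) := by
  obtain ⟨B, Q, n, l, hB, hl, he⟩ := exists_types_memEquiv hφ
  have hred : Reducible (disjList (l.map (fex a))) := by
    refine modalClosed_reducible.disjList ?_
    rw [List.forall_mem_map]
    exact fun χ hχ => reducible_fex_of_mem_types a hB (hl hχ)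
  refine hred.of_memEquiv fun Γ hΓ => ?_
  simp only [hΓ.disjList_mem, List.mem_map, exists_exists_and_eq_and, hΓ.fex_mem]
  constructor
  · rintro ⟨Δ, hΔ, hR, h⟩
    obtain ⟨χ, hχ, h⟩ := (hΔ.disjList_mem l).1 ((he Δ hΔ).1 h)
    exact ⟨χ, hχ, Δ, hΔ, hR, h⟩
  · rintro ⟨χ, hχ, Δ, hΔ, hR, h⟩
    exact ⟨Δ, hΔ, hR, (he Δ hΔ).2 ((hΔ.disjList_mem l).2 ⟨χ, hχ, h⟩)⟩

theorem reducible (φ : RForm A P) : Reducible φ := by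
  induction φ with
  | atom p => exact modalClosed_reducible.atom p
  | neg φ ih => exact modalClosed_reducible.neg ih
  | and φ ψ ih₁ ih₂ => exact modalClosed_reducible.and ih₁ ih₂
  | box a φ ih => exact modalClosed_reducible.box ih
  | rall a φ ih =>
    obtain ⟨ψ, hψ, he⟩ := ih
    refine (modalClosed_reducible.neg (reducible_fex_of_rFree a (φ := .neg ψ) hψ)).of_memEquiv
      fun Γ hΓ => ?_
    rw [fex, hΓ.neg_mem, hΓ.neg_mem, not_not, hΓ.rall_mem, hΓ.rall_mem]
    refine forall₂_congr fun Δ hΔ => ?_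
    rw [hΔ.neg_mem, hΔ.neg_mem, not_not, he Δ hΔ]

theorem complete {φ : RForm A P} (h : Valid φ) : Deriv φ := by
  obtain ⟨ψ, hψ, he⟩ := reducible φ
  have hiff : Deriv (fiff φ ψ) := deriv_of_forall_mem fun Γ hΓ => by
    rw [fiff, hΓ.and_mem, hΓ.fimp_mem, hΓ.fimp_mem, he Γ hΓ]
    exact ⟨id, id⟩
  refine deriv_of_forall_mem fun Γ hΓ => (he Γ hΓ).2 ((sat_canonicalModel hψ ⟨Γ, hΓ⟩).1 ?_)
  exact ((sat_fiff _ _ φ ψ).1 (sound hiff _ _)).1 (h _ _)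

end Canonical

end RML

/-- Soundness and completeness of **RML**: `⊢ φ` iff `⊨ φ`. -/
theorem RML_sound_and_complete {A P : Type} [Inhabited P] (φ : RForm A P) :
    Deriv φ ↔ Valid φ := by
  exact ⟨RML.sound, RML.complete⟩
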